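/- For every finite set T of transition constraints, p(T) is nonempty if and only if L ≤ U pointwise, where L i := max({0} ∪ {c | a lower requirement '≥ c' at index i belongs to T}) and U i := min({m i} ∪ {c | an upper requirement '≤ c' at index i belongs to T}); i.e., the abstract interval p^#(T) = Set.Icc L U is nonempty if and only if some parametrisation enables all constraints in T. -/

import Mathlib

/-!
STATEMENT 2: For every finite set T of transition constraints, p(T) is nonempty iff
L ≤ U pointwise, where L i := max({0} ∪ {c | (i,≥c) ∈ T}) and
U i := min({m i} ∪ {c | (i,≤c) ∈ T}); i.e., the abstract interval p^#(T) = Set.Icc L U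
is nonempty iff some parametrisation enables all constraints in T.
-/

namespace PRN2

inductive Req : Type
  | lower (c : ℕ)
  | upper (c : ℕ)
deriving DecidableEq

variable {I : Type*}

/-- The parametrisation space `𝔓`: functions bounded by `m` pointwise. -/
def Param (m : I → ℕ) : Set (I → ℕ) := {P | ∀ i, P i ≤ m i}

/-- A parametrisation satisfies a transition constraint `(i, γ)`. -/
def Sat (P : I → ℕ) : I × Req → Prop
  | (i, .lower c) => c ≤ P i
  | (i, .upper c) => P i ≤ c

/-- `p(T)`: the set of parametrisations in `𝔓` enabling all constraints in `T`. -/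
def pSet (m : I → ℕ) (T : Finset (I × Req)) : Set (I → ℕ) :=
  {P | P ∈ Param m ∧ ∀ t ∈ T, Sat P t}

/-- `L i := max({0} ∪ {c | (i, ≥c) ∈ T})`. -/
noncomputable def lowBound (T : Finset (I × Req)) (i : I) : ℕ :=
  sSup ({0} ∪ {c | (i, Req.lower c) ∈ T})

/-- `U i := min({m i} ∪ {c | (i, ≤c) ∈ T})`. -/
noncomputable def uppBound (m : I → ℕ) (T : Finset (I × Req)) (i : I) : ℕ :=
  sInf ({m i} ∪ {c | (i, Req.upper c) ∈ T})


theorem finite_lower (T : Finset (I × Req)) (i : I) : {c | (i, Req.lower c) ∈ T}.Finite :=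
  T.finite_toSet.preimage (f := fun c => (i, Req.lower c)) fun a _ b _ h => by simpa using h

theorem lowBound_le_iff (T : Finset (I × Req)) (i : I) (n : ℕ) :
    lowBound T i ≤ n ↔ ∀ c, (i, Req.lower c) ∈ T → c ≤ n := by
  have hbdd : BddAbove ({0} ∪ {c | (i, Req.lower c) ∈ T}) :=
    ((Set.finite_singleton 0).union (finite_lower T i)).bddAbove
  rw [lowBound, csSup_le_iff hbdd ⟨0, by simp⟩]
  simp

theorem le_uppBound_iff (m : I → ℕ) (T : Finset (I × Req)) (i : I) (n : ℕ) :
    n ≤ uppBound m T i ↔ n ≤ m i ∧ ∀ c, (i, Req.upper c) ∈ T → n ≤ c := by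
  rw [uppBound, le_csInf_iff (OrderBot.bddBelow _) ⟨m i, by simp⟩]
  simp

/-- The parametrisations enabling all constraints in `T` form an order interval. -/
theorem pSet_eq_Icc (m : I → ℕ) (T : Finset (I × Req)) :
    pSet m T = Set.Icc (lowBound T) (uppBound m T) := by
  ext P
  simp only [Set.mem_Icc, Pi.le_def, lowBound_le_iff, le_uppBound_iff]
  constructor
  · rintro ⟨hm, hT⟩
    exact ⟨fun i c h => hT _ h, fun i => ⟨hm i, fun c h => hT _ h⟩⟩
  · rintro ⟨hl, hu⟩
    refine ⟨fun i => (hu i).1, ?_⟩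
    rintro ⟨i, c | c⟩ h
    · exact hl i c h
    · exact (hu i).2 c h

theorem pT_nonempty_iff_le [Fintype I] (m : I → ℕ) (T : Finset (I × Req))
    (hTlow : ∀ i c, (i, Req.lower c) ∈ T → 1 ≤ c ∧ c ≤ m i)
    (hTupp : ∀ i c, (i, Req.upper c) ∈ T → c ≤ m i - 1) :
    (pSet m T).Nonempty ↔ lowBound T ≤ uppBound m T := by
  rw [pSet_eq_Icc, Set.nonempty_Icc]

end PRN2
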